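/- Let p ≥ 2 and n ≥ 1 be integers, let X₁, …, Xₙ be independent random variables each uniform on {p−1, p−3, …, 1−p}, let a₁, …, aₙ be positive reals, and set X̃ = ∑_{j=1}^n a_jX_j. Then E[X̃^m] = E[Y^m] for all 1 ≤ m ≤ 2n, where Y is uniform on [−1,1], if and only if ∑_{j=1}^n a_j^{2k} = 1/(p^{2k}−1) for all 1 ≤ k ≤ n. -/

import Mathlib

/-- The value of `X̃ = ∑ aⱼ Xⱼ` when `Xⱼ` takes the value `p - 1 - 2·(x j)`
in the arithmetic progression `{p-1, p-3, …, 1-p}`. -/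
noncomputable def Xsum (p n : ℕ) (a : Fin n → ℝ) (x : Fin n → Fin p) : ℝ :=
  ∑ j, a j * ((p : ℝ) - 1 - 2 * ((x j : ℕ) : ℝ))

open PowerSeries in
/-- Two power series with constant coefficient `1` agree up to order `N` if and only if their
logarithmic derivatives `f`, `g` agree up to order `N - 1`. -/
theorem coeff_eq_iff_coeff_logDeriv_eq {F G f g : PowerSeries ℝ}
    (hF : constantCoeff F = 1) (hG : constantCoeff G = 1)
    (hf : derivative ℝ F = f * F) (hg : derivative ℝ G = g * G) (N : ℕ) :
    (∀ m < N + 1, coeff m F = coeff m G) ↔ ∀ m < N, coeff m f = coeff m g := by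
  have e : ∀ (A B : PowerSeries ℝ) (M : ℕ),
      (∀ m < M, coeff m A = coeff m B) ↔ (X : PowerSeries ℝ) ^ M ∣ A - B := by
    intro A B M
    simp only [X_pow_dvd_iff, map_sub, sub_eq_zero]
  have key : derivative ℝ (F - G) = (f - g) * F + g * (F - G) := by
    rw [map_sub, hf, hg]; ring
  have hu : IsUnit F := isUnit_iff_constantCoeff.mpr (by simp [hF])
  rw [e, e]
  constructor
  · intro h
    have h1 : (X : PowerSeries ℝ) ^ N ∣ derivative ℝ (F - G) := by
      rw [X_pow_dvd_iff] at h ⊢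
      intro m hm
      rw [coeff_derivative, h (m + 1) (by omega), zero_mul]
    have h2 : (X : PowerSeries ℝ) ^ N ∣ g * (F - G) :=
      Dvd.dvd.mul_left ((pow_dvd_pow _ (Nat.le_succ N)).trans h) g
    rw [key] at h1
    exact (hu.dvd_mul_right).mp ((dvd_add_left h2).mp h1)
  · intro h
    have : ∀ k ≤ N + 1, (X : PowerSeries ℝ) ^ k ∣ F - G := by
      intro k
      induction k with
      | zero => intro _; simp
      | succ k ih =>
        intro hk
        have h1 : (X : PowerSeries ℝ) ^ k ∣ derivative ℝ (F - G) := by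
          rw [key]
          exact dvd_add (Dvd.dvd.mul_right ((pow_dvd_pow _ (by omega)).trans h) F)
            (Dvd.dvd.mul_left (ih (by omega)) g)
        rw [X_pow_dvd_iff] at h1 ⊢
        intro m hm
        cases m with
        | zero => simp [hF, hG]
        | succ m =>
          have h2 := h1 m (by omega)
          rw [coeff_derivative] at h2
          exact (mul_eq_zero.mp h2).resolve_right (by positivity)
    exact this _ le_rfl

open PowerSeries in
theorem derivative_rescale (c : ℝ) (F : PowerSeries ℝ) :
    derivative ℝ (rescale c F) = C c * rescale c (derivative ℝ F) := by
  ext m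
  simp only [coeff_derivative, coeff_rescale, coeff_C_mul]
  ring

open PowerSeries in
theorem derivative_prod_of_logDeriv {ι : Type*} (s : Finset ι) (M f : ι → PowerSeries ℝ)
    (h : ∀ j ∈ s, derivative ℝ (M j) = f j * M j) :
    derivative ℝ (∏ j ∈ s, M j) = (∑ j ∈ s, f j) * ∏ j ∈ s, M j := by
  classical
  induction s using Finset.induction_on with
  | empty => simp
  | insert j s hj ih =>
    rw [Finset.prod_insert hj, Finset.sum_insert hj, Derivation.leibniz,
      ih fun i hi => h i (Finset.mem_insert_of_mem hi), h j (Finset.mem_insert_self j s)]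
    simp only [smul_eq_mul]
    ring

/-- The power series of `sinh t / t`. -/
noncomputable def sinhc : PowerSeries ℝ :=
  PowerSeries.mk fun m => if Even m then 1 / ((m + 1).factorial : ℝ) else 0

/-- The power series of `coth t - 1 / t`, the logarithmic derivative of `sinh t / t`. -/
noncomputable def langevin : PowerSeries ℝ :=
  PowerSeries.derivative ℝ sinhc * sinhc⁻¹

open PowerSeries in
theorem constantCoeff_sinhc : constantCoeff sinhc = 1 := by
  rw [← coeff_zero_eq_constantCoeff_apply, sinhc, coeff_mk]
  simp

theorem sinhc_ne_zero : sinhc ≠ 0 := by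
  intro h
  have := constantCoeff_sinhc
  simp [h] at this

open PowerSeries in
theorem derivative_sinhc : derivative ℝ sinhc = langevin * sinhc := by
  rw [langevin, mul_assoc, PowerSeries.inv_mul_cancel _ (by simp [constantCoeff_sinhc]), mul_one]

open PowerSeries in
theorem sinhc_ode :
    2 * derivative ℝ sinhc + X * derivative ℝ (derivative ℝ sinhc) = X * sinhc := by
  have h2 : (2 : PowerSeries ℝ) = C 2 := (map_ofNat C 2).symm
  ext m
  rw [h2]
  cases m with
  | zero =>
    rw [map_add, coeff_zero_X_mul, coeff_zero_X_mul, coeff_C_mul, coeff_derivative, sinhc, coeff_mk]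
    simp
  | succ m =>
    simp only [map_add, coeff_C_mul, coeff_succ_X_mul, coeff_derivative, sinhc, coeff_mk]
    by_cases hm : Even m
    · have : Even (m + 1 + 1) := by grind
      simp only [hm, this, if_true, Nat.factorial_succ]
      push_cast
      field_simp
      ring
    · have : ¬ Even (m + 1 + 1) := by grind
      simp [hm, this]

open PowerSeries in
theorem langevin_riccati :
    X * derivative ℝ langevin + 2 * langevin + X * (langevin * langevin) = X := by
  have h := sinhc_ode
  rw [derivative_sinhc, Derivation.leibniz, derivative_sinhc] at h
  simp only [smul_eq_mul] at h
  apply mul_right_cancel₀ sinhc_ne_zero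
  linear_combination h

open PowerSeries in
theorem coeff_zero_langevin : coeff 0 langevin = 0 := by
  have h2 : (2 : PowerSeries ℝ) = C 2 := (map_ofNat C 2).symm
  have h := congrArg (coeff 0) langevin_riccati
  rw [h2] at h
  simpa using h

open PowerSeries in
theorem coeff_succ_langevin (m : ℕ) :
    ((m : ℝ) + 3) * coeff (m + 1) langevin =
      (if m = 0 then 1 else 0) -
        ∑ q ∈ Finset.HasAntidiagonal.antidiagonal m, coeff q.1 langevin * coeff q.2 langevin := by
  have h2 : (2 : PowerSeries ℝ) = C 2 := (map_ofNat C 2).symm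
  have h := congrArg (coeff (m + 1)) langevin_riccati
  rw [h2] at h
  simp only [map_add, coeff_C_mul, coeff_succ_X_mul, coeff_derivative, coeff_X,
    Nat.add_eq_right] at h
  rw [coeff_mul] at h
  linear_combination h

open PowerSeries in
theorem coeff_langevin_of_even (m : ℕ) (hm : Even m) : coeff m langevin = 0 := by
  induction m using Nat.strong_induction_on with
  | _ m ih =>
    cases m with
    | zero => exact coeff_zero_langevin
    | succ m =>
      have h := coeff_succ_langevin m
      rw [Finset.sum_eq_zero, if_neg (by grind), sub_zero] at h
      · exact (mul_eq_zero.mp h).resolve_left (by positivity)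
      · rintro ⟨i, j⟩ hij
        rw [Finset.HasAntidiagonal.mem_antidiagonal] at hij
        simp only at hij ⊢
        by_cases hi : Even i
        · rw [ih i (by omega) hi, zero_mul]
        · rw [ih j (by omega) (by grind), mul_zero]

open PowerSeries in
/-- The nonzero coefficients of `coth t - 1 / t` alternate in sign. -/
theorem coeff_langevin_sign (k : ℕ) : 0 < (-1 : ℝ) ^ k * coeff (2 * k + 1) langevin := by
  induction k using Nat.strong_induction_on with
  | _ k ih =>
    cases k with
    | zero =>
      have h := coeff_succ_langevin 0
      rw [Finset.Nat.antidiagonal_zero, Finset.sum_singleton, coeff_zero_langevin] at h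
      norm_num at h ⊢
      linarith
    | succ k =>
      have h := coeff_succ_langevin (2 * (k + 1))
      rw [if_neg (by omega), zero_sub] at h
      have hprod : ∀ r s : ℕ, r + s = k →
          0 < (-1 : ℝ) ^ k * (coeff (2 * r + 1) langevin * coeff (2 * s + 1) langevin) := by
        intro r s hrs
        have := mul_pos (ih r (by omega)) (ih s (by omega))
        rw [← hrs, pow_add]
        linarith
      have hpos : 0 < ∑ q ∈ Finset.HasAntidiagonal.antidiagonal (2 * (k + 1)),
          (-1 : ℝ) ^ k * (coeff q.1 langevin * coeff q.2 langevin) := by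
        apply Finset.sum_pos'
        · rintro ⟨i, j⟩ hij
          rw [Finset.HasAntidiagonal.mem_antidiagonal] at hij
          simp only at hij ⊢
          rcases Nat.even_or_odd i with hi | ⟨r, hr⟩
          · simp [coeff_langevin_of_even i hi]
          · obtain ⟨s, hs⟩ : Odd j := by grind
            subst hr hs
            exact (hprod r s (by omega)).le
        · exact ⟨(2 * 0 + 1, 2 * k + 1), by rw [Finset.HasAntidiagonal.mem_antidiagonal]; ring,
            hprod 0 k (by omega)⟩
      rw [← Finset.mul_sum] at hpos
      have h3 : (0 : ℝ) < ((2 * (k + 1) : ℕ) : ℝ) + 3 := by positivity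
      refine pos_of_mul_pos_right ?_ h3.le
      calc (0 : ℝ) < _ := hpos
        _ = _ := by rw [pow_succ]; linear_combination (-1 : ℝ) ^ k * h

open PowerSeries in
theorem coeff_langevin_of_odd (m : ℕ) (hm : Odd m) : coeff m langevin ≠ 0 := by
  obtain ⟨k, rfl⟩ := hm
  exact right_ne_zero_of_mul (coeff_langevin_sign k).ne'

open PowerSeries in
theorem two_mul_X_mul_rescale_sinhc (c : ℝ) :
    C (2 * c) * X * rescale c sinhc = rescale c (exp ℝ) - rescale (-c) (exp ℝ) := by
  ext m
  rw [mul_assoc, coeff_C_mul]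
  cases m with
  | zero => rw [map_sub, coeff_rescale, coeff_rescale]; simp
  | succ m =>
    simp only [coeff_succ_X_mul, coeff_rescale, map_sub, sinhc, coeff_mk, coeff_exp]
    by_cases hm : Even m
    · have : Odd (m + 1) := by grind
      simp only [hm, if_true, this.neg_pow]
      simp
      ring
    · have : Even (m + 1) := by grind
      simp [hm, this.neg_pow]

/-- The moment generating function of `c X`, where `X` is uniform on `{p-1, p-3, …, 1-p}`. -/
noncomputable def progressionMgf (p : ℕ) (c : ℝ) : PowerSeries ℝ :=
  PowerSeries.C (1 / (p : ℝ)) *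
    ∑ i : Fin p, PowerSeries.rescale (c * ((p : ℝ) - 1 - 2 * ((i : ℕ) : ℝ))) (PowerSeries.exp ℝ)

open PowerSeries in
theorem progressionMgf_mul_rescale_sinhc {p : ℕ} (hp : p ≠ 0) {c : ℝ} (hc : c ≠ 0) :
    progressionMgf p c * rescale c sinhc = rescale (p * c) sinhc := by
  have hp' : (p : ℝ) ≠ 0 := Nat.cast_ne_zero.mpr hp
  have tel : (∑ i : Fin p, rescale (c * ((p : ℝ) - 1 - 2 * ((i : ℕ) : ℝ))) (exp ℝ)) *
      (rescale c (exp ℝ) - rescale (-c) (exp ℝ)) =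
        rescale (p * c) (exp ℝ) - rescale (-(p * c)) (exp ℝ) := by
    rw [Fin.sum_univ_eq_sum_range
      (fun i : ℕ => rescale (c * ((p : ℝ) - 1 - 2 * (i : ℝ))) (exp ℝ)) p, Finset.sum_mul]
    have := Finset.sum_range_sub' (fun i : ℕ => rescale (c * ((p : ℝ) - 2 * (i : ℝ))) (exp ℝ)) p
    convert this using 1
    · refine Finset.sum_congr rfl fun i _ => ?_
      rw [mul_sub, exp_mul_exp_eq_exp_add, exp_mul_exp_eq_exp_add]
      congr 3 <;> push_cast <;> ring
    · congr 3 <;> push_cast <;> ring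
  have hX : (C (2 * (p * c)) * X : PowerSeries ℝ) ≠ 0 := by
    refine mul_ne_zero ?_ X_ne_zero
    rw [Ne, map_eq_zero_iff _ C_injective]
    positivity
  apply mul_left_cancel₀ hX
  rw [two_mul_X_mul_rescale_sinhc, ← tel, ← two_mul_X_mul_rescale_sinhc, progressionMgf]
  have : (C (2 * (p * c)) * C (1 / (p : ℝ)) : PowerSeries ℝ) = C (2 * c) := by
    rw [← map_mul]; congr 1; field_simp
  rw [← this]
  ring

open PowerSeries in
theorem derivative_progressionMgf {p : ℕ} (hp : p ≠ 0) {c : ℝ} (hc : c ≠ 0) :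
    derivative ℝ (progressionMgf p c) =
      (C (p * c) * rescale (p * c) langevin - C c * rescale c langevin) *
        progressionMgf p c := by
  have h := progressionMgf_mul_rescale_sinhc hp hc
  have hd := congrArg (derivative ℝ) h
  rw [Derivation.leibniz, derivative_rescale, derivative_rescale, derivative_sinhc,
    map_mul (rescale c), map_mul (rescale (p * c)), ← h] at hd
  simp only [smul_eq_mul] at hd
  have h0 : rescale c sinhc ≠ 0 := by
    rw [Ne, map_eq_zero_iff _ (rescale_injective hc)]
    exact sinhc_ne_zero
  apply mul_right_cancel₀ h0
  linear_combination hd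

open PowerSeries in
theorem rescale_exp_sum {ι : Type*} (s : Finset ι) (c : ι → ℝ) :
    rescale (∑ j ∈ s, c j) (exp ℝ) = ∏ j ∈ s, rescale (c j) (exp ℝ) := by
  classical
  induction s using Finset.induction_on with
  | empty => simp
  | insert j s hj ih =>
    rw [Finset.prod_insert hj, Finset.sum_insert hj, ← ih, exp_mul_exp_eq_exp_add]

open PowerSeries in
theorem prod_progressionMgf (p n : ℕ) (a : Fin n → ℝ) :
    ∏ j, progressionMgf p (a j) =
      C (1 / (p : ℝ) ^ n) * ∑ x : Fin n → Fin p, rescale (Xsum p n a x) (exp ℝ) := by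
  simp only [progressionMgf, Finset.prod_mul_distrib, Finset.prod_const, Finset.card_univ,
    Fintype.card_fin, Xsum, rescale_exp_sum]
  rw [Fintype.prod_sum, ← map_pow, one_div_pow]

open PowerSeries in
theorem factorial_mul_coeff_prod_progressionMgf (p n : ℕ) (a : Fin n → ℝ) (m : ℕ) :
    (m.factorial : ℝ) * coeff m (∏ j, progressionMgf p (a j)) =
      (1 / (p : ℝ) ^ n) * ∑ x : Fin n → Fin p, (Xsum p n a x) ^ m := by
  have hm : (m.factorial : ℝ) ≠ 0 := by positivity
  rw [prod_progressionMgf, coeff_C_mul, map_sum]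
  simp only [coeff_rescale, coeff_exp, ← Finset.sum_mul]
  simp
  field_simp

open PowerSeries in
theorem factorial_mul_coeff_sinhc (m : ℕ) :
    (m.factorial : ℝ) * coeff m sinhc = if Even m then 1 / ((m : ℝ) + 1) else 0 := by
  rw [sinhc, coeff_mk]
  split_ifs
  · rw [Nat.factorial_succ]
    push_cast
    field_simp
  · simp

open PowerSeries in
theorem constantCoeff_progressionMgf {p : ℕ} (hp : p ≠ 0) {c : ℝ} (hc : c ≠ 0) :
    constantCoeff (progressionMgf p c) = 1 := by
  have h := congrArg constantCoeff (progressionMgf_mul_rescale_sinhc hp hc)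
  have hr : ∀ b : ℝ, constantCoeff (rescale b sinhc) = 1 := fun b => by
    rw [← coeff_zero_eq_constantCoeff_apply, coeff_rescale, pow_zero, one_mul,
      coeff_zero_eq_constantCoeff_apply, constantCoeff_sinhc]
  rwa [map_mul, hr, hr, mul_one] at h

theorem stmt_3 (p : ℕ) (hp : 2 ≤ p) (n : ℕ) (hn : 1 ≤ n)
    (a : Fin n → ℝ) (hpos : ∀ j, 0 < a j) :
    (∀ m : ℕ, 1 ≤ m → m ≤ 2 * n →
        (1 / (p : ℝ) ^ n) * ∑ x : Fin n → Fin p, (Xsum p n a x) ^ m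
          = if Even m then 1 / ((m : ℝ) + 1) else 0) ↔
      (∀ k : ℕ, 1 ≤ k → k ≤ n →
        ∑ j, a j ^ (2 * k) = 1 / ((p : ℝ) ^ (2 * k) - 1)) := by
  have hp0 : p ≠ 0 := by omega
  have ha : ∀ j, a j ≠ 0 := fun j => (hpos j).ne'
  have hF : PowerSeries.constantCoeff (∏ j, progressionMgf p (a j)) = 1 := by
    rw [map_prod]
    exact Finset.prod_eq_one fun j _ => constantCoeff_progressionMgf hp0 (ha j)
  have hlog := coeff_eq_iff_coeff_logDeriv_eq hF constantCoeff_sinhc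
    (derivative_prod_of_logDeriv Finset.univ _ _
      fun j _ => derivative_progressionMgf hp0 (ha j)) derivative_sinhc (2 * n)
  have hcoeff : ∀ m, PowerSeries.coeff m (∑ j, (PowerSeries.C (p * a j) *
      PowerSeries.rescale (p * a j) langevin -
        PowerSeries.C (a j) * PowerSeries.rescale (a j) langevin)) =
      (((p : ℝ) ^ (m + 1) - 1) * ∑ j, a j ^ (m + 1)) * PowerSeries.coeff m langevin := by
    intro m
    rw [map_sum, Finset.mul_sum, Finset.sum_mul]
    refine Finset.sum_congr rfl fun j _ => ?_
    simp only [map_sub, PowerSeries.coeff_C_mul, PowerSeries.coeff_rescale]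
    ring
  have hmoments : (∀ m : ℕ, 1 ≤ m → m ≤ 2 * n →
        (1 / (p : ℝ) ^ n) * ∑ x : Fin n → Fin p, (Xsum p n a x) ^ m
          = if Even m then 1 / ((m : ℝ) + 1) else 0) ↔
      ∀ m < 2 * n + 1, PowerSeries.coeff m (∏ j, progressionMgf p (a j)) =
        PowerSeries.coeff m sinhc := by
    have hiff : ∀ m : ℕ, ((1 / (p : ℝ) ^ n) * ∑ x : Fin n → Fin p, (Xsum p n a x) ^ m
          = if Even m then 1 / ((m : ℝ) + 1) else 0) ↔
        PowerSeries.coeff m (∏ j, progressionMgf p (a j)) = PowerSeries.coeff m sinhc := by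
      intro m
      rw [← factorial_mul_coeff_prod_progressionMgf, ← factorial_mul_coeff_sinhc]
      exact mul_right_inj' (by positivity)
    simp only [hiff]
    constructor
    · intro h m hm
      rcases Nat.eq_zero_or_pos m with rfl | hm0
      · rw [PowerSeries.coeff_zero_eq_constantCoeff_apply, hF,
          PowerSeries.coeff_zero_eq_constantCoeff_apply, constantCoeff_sinhc]
      · exact h m hm0 (by omega)
    · exact fun h m _ hm => h m (by omega)
  rw [hmoments, hlog]
  simp only [hcoeff]
  have hne : ∀ k : ℕ, 1 ≤ k → (p : ℝ) ^ (2 * k) - 1 ≠ 0 := by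
    intro k hk
    have : (1 : ℝ) < (p : ℝ) ^ (2 * k) :=
      one_lt_pow₀ (by exact_mod_cast hp) (by omega)
    linarith
  constructor
  · intro h k hk hkn
    have h1 := h (2 * k - 1) (by omega)
    rw [Nat.sub_add_cancel (by omega)] at h1
    have h2 := (mul_eq_right₀ (coeff_langevin_of_odd _ (by grind))).mp h1
    rw [eq_div_iff (hne k hk), mul_comm]
    exact h2
  · intro h m hm
    rcases Nat.even_or_odd m with he | ⟨k, rfl⟩
    · rw [coeff_langevin_of_even m he, mul_zero]
    · have h1 := h (k + 1) (by omega) (by omega)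
      have h2 := hne (k + 1) (by omega)
      rw [show 2 * k + 1 + 1 = 2 * (k + 1) by ring, h1, mul_one_div_cancel h2, one_mul]
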